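/- Nested session types admit a sequential composition: the class of linear tail type functions S (generated by λα.α, λα.V[S α], λα.⊕{ℓ : S_ℓ α}_{ℓ∈L}, λα.&{ℓ : S_ℓ α}_{ℓ∈L}, λα.A ⊗ (S α), and λα.A ⊸ (S α)) contains the identity λα.α and is closed under function composition; moreover composition right-distributes over the type constructors: (λα.V[S α]) ∘ T = λα.V[(S ∘ T) α], (λα.⊕{ℓ : S_ℓ α}_{ℓ∈L}) ∘ T = λα.⊕{ℓ : (S_ℓ ∘ T) α}_{ℓ∈L}, (λα.&{ℓ : S_ℓ α}_{ℓ∈L}) ∘ T = λα.&{ℓ : (S_ℓ ∘ T) α}_{ℓ∈L}, (λα.A ⊗ (S α)) ∘ T = λα.A ⊗ ((S ∘ T) α), and (λα.A ⊸ (S α)) ∘ T = λα.A ⊸ ((S ∘ T) α); hence S ; T := S ∘ T satisfies the laws of a right-distributive monoid on this class. -/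

import Mathlib

/-- Labels for internal/external choice. -/
abbrev Label := Nat
/-- Type variables. -/
abbrev TVar := Nat
/-- Defined type names. -/
abbrev TName := Nat

/-- Session types: internal choice, external choice, tensor, lolli, 1,
type variables, and applications `V[B₁,…,Bₙ]` of defined type names
(represented by an arity `n` together with a function giving the arguments). -/
inductive STy : Type where
  | ichoice : List Label → (Label → STy) → STy
  | echoice : List Label → (Label → STy) → STy
  | tensor  : STy → STy → STy
  | lolli   : STy → STy → STy
  | one     : STy
  | var     : TVar → STy
  | app     : TName → (n : Nat) → (Nat → STy) → STy

namespace STy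

/-- Capture-free substitution of types for type variables. -/
def subst (σ : TVar → STy) : STy → STy
  | ichoice L f => ichoice L (fun l => (f l).subst σ)
  | echoice L f => echoice L (fun l => (f l).subst σ)
  | tensor A B  => tensor (A.subst σ) (B.subst σ)
  | lolli A B   => lolli (A.subst σ) (B.subst σ)
  | one         => one
  | var a       => σ a
  | app V n f   => app V n (fun i => (f i).subst σ)

/-- Free type variables. -/
def fv : STy → Set TVar
  | ichoice L f => {a | ∃ l ∈ L, a ∈ (f l).fv}
  | echoice L f => {a | ∃ l ∈ L, a ∈ (f l).fv}
  | tensor A B  => A.fv ∪ B.fv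
  | lolli A B   => A.fv ∪ B.fv
  | one         => ∅
  | var a       => {a}
  | app _ n f   => {a | ∃ i < n, a ∈ (f i).fv}

/-- A type is closed if it has no free type variables. -/
def closed (A : STy) : Prop := A.fv = ∅

/-- Defined type names occurring in a type. -/
def names : STy → Set TName
  | ichoice L f => {V | ∃ l ∈ L, V ∈ (f l).names}
  | echoice L f => {V | ∃ l ∈ L, V ∈ (f l).names}
  | tensor A B  => A.names ∪ B.names
  | lolli A B   => A.names ∪ B.names
  | one         => ∅
  | var _       => ∅
  | app V n f   => insert V {W | ∃ i < n, W ∈ (f i).names}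

/-- Labels occurring in a type. -/
def labels : STy → Set Label
  | ichoice L f => {l | l ∈ L} ∪ {l | ∃ l' ∈ L, l ∈ (f l').labels}
  | echoice L f => {l | l ∈ L} ∪ {l | ∃ l' ∈ L, l ∈ (f l').labels}
  | tensor A B  => A.labels ∪ B.labels
  | lolli A B   => A.labels ∪ B.labels
  | one         => ∅
  | var _       => ∅
  | app _ n f   => {l | ∃ i < n, l ∈ (f i).labels}

/-- A type is a type-name application. -/
def isApp : STy → Prop
  | app _ _ _ => True
  | _ => False

end STy

/-- A signature: a partial map from type names to (arity, body) definitions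
`V[α₀,…,α_{n-1}] = A` (at most one definition per name). -/
abbrev Sig := TName → Option (Nat × STy)

/-- Domain of a signature. -/
def Sig.dom (Sg : Sig) : Set TName := {V | Sg V ≠ none}

/-- A signature is contractive: no definition body is itself a type name
application. -/
def Contractive (Sg : Sig) : Prop :=
  ∀ V n A, Sg V = some (n, A) → ¬ A.isApp

/-- Unfolding: `unfold (V[B̄]) = A[B̄/ᾱ]` when `V[ᾱ] = A ∈ Σ`, and
`unfold A = A` otherwise. -/
def unfoldT (Sg : Sig) : STy → STy
  | .app V n f =>
      match Sg V with
      | some (_, A) => A.subst f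
      | none        => .app V n f
  | A => A

/-- A relation on (closed) session types is a type bisimulation. -/
def IsBisim (Sg : Sig) (R : STy → STy → Prop) : Prop :=
  ∀ A B, R A B →
    (∀ L f, unfoldT Sg A = .ichoice L f →
      ∃ g, unfoldT Sg B = .ichoice L g ∧ ∀ l ∈ L, R (f l) (g l)) ∧
    (∀ L f, unfoldT Sg A = .echoice L f →
      ∃ g, unfoldT Sg B = .echoice L g ∧ ∀ l ∈ L, R (f l) (g l)) ∧
    (∀ A1 A2, unfoldT Sg A = .tensor A1 A2 →
      ∃ B1 B2, unfoldT Sg B = .tensor B1 B2 ∧ R A1 B1 ∧ R A2 B2) ∧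
    (∀ A1 A2, unfoldT Sg A = .lolli A1 A2 →
      ∃ B1 B2, unfoldT Sg B = .lolli B1 B2 ∧ R A1 B1 ∧ R A2 B2) ∧
    (unfoldT Sg A = .one → unfoldT Sg B = .one)

/-- Type equality `A ≡_Σ B` of closed types: some type bisimulation (on
closed types) relates `A` and `B`. -/
def TypeEq (Sg : Sig) (A B : STy) : Prop :=
  ∃ R : STy → STy → Prop,
    IsBisim Sg R ∧ (∀ X Y, R X Y → X.closed ∧ Y.closed) ∧ R A B

/-- Open type equality `∀𝒱. A ≡_Σ B`: equality of all closed instances. -/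
def EqForall (Sg : Sig) (Vs : Set TVar) (A B : STy) : Prop :=
  ∀ σ : TVar → STy, (∀ a ∈ Vs, (σ a).closed) →
    TypeEq Sg (A.subst σ) (B.subst σ)
/-- The linear, tail functions from types to types (with unary type
constructors only): `λα.α`, `λα.V[S α]`, `λα.⊕{ℓ : S_ℓ α}_{ℓ∈L}`,
`λα.&{ℓ : S_ℓ α}_{ℓ∈L}`, `λα.A ⊗ (S α)`, and `λα.A ⊸ (S α)`. -/
inductive TailFn : (STy → STy) → Prop where
  | id : TailFn (fun a => a)
  | name (V : TName) (S : STy → STy) : TailFn S →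
      TailFn (fun a => .app V 1 (fun _ => S a))
  | ichoice (L : List Label) (S : Label → STy → STy) :
      (∀ l ∈ L, TailFn (S l)) →
      TailFn (fun a => .ichoice L (fun l => S l a))
  | echoice (L : List Label) (S : Label → STy → STy) :
      (∀ l ∈ L, TailFn (S l)) →
      TailFn (fun a => .echoice L (fun l => S l a))
  | tensor (A : STy) (S : STy → STy) : TailFn S →
      TailFn (fun a => .tensor A (S a))
  | lolli (A : STy) (S : STy → STy) : TailFn S →
      TailFn (fun a => .lolli A (S a))

/-- Linear tail type functions are closed under composition. -/
theorem TailFn.comp {S T : STy → STy} (hS : TailFn S) (hT : TailFn T) : TailFn (S ∘ T) := by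
  induction hS with
  | id => exact hT
  | name V S _ ih => exact .name V (S ∘ T) ih
  | ichoice L S _ ih => exact .ichoice L (fun l => S l ∘ T) ih
  | echoice L S _ ih => exact .echoice L (fun l => S l ∘ T) ih
  | tensor A S _ ih => exact .tensor A (S ∘ T) ih
  | lolli A S _ ih => exact .lolli A (S ∘ T) ih

/-- **Theorem (Statement 15).** Nested session types admit a sequential
composition: the class of linear tail type functions contains the identity
and is closed under composition; composition right-distributes over the type
constructors; and together with the monoid laws of composition this makes
`S ; T := S ∘ T` a right-distributive monoid operation on this class. -/
theorem tailFn_sequential_composition :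
    -- the identity is a linear tail function
    TailFn (fun a => a) ∧
    -- closure under composition
    (∀ S T : STy → STy, TailFn S → TailFn T → TailFn (S ∘ T)) ∧
    -- right-distributivity over the connectives
    (∀ (V : TName) (S T : STy → STy),
      (fun a => STy.app V 1 (fun _ => S a)) ∘ T
        = fun a => STy.app V 1 (fun _ => (S ∘ T) a)) ∧
    (∀ (L : List Label) (S : Label → STy → STy) (T : STy → STy),
      (fun a => STy.ichoice L (fun l => S l a)) ∘ T
        = fun a => STy.ichoice L (fun l => ((S l) ∘ T) a)) ∧
    (∀ (L : List Label) (S : Label → STy → STy) (T : STy → STy),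
      (fun a => STy.echoice L (fun l => S l a)) ∘ T
        = fun a => STy.echoice L (fun l => ((S l) ∘ T) a)) ∧
    (∀ (A : STy) (S T : STy → STy),
      (fun a => STy.tensor A (S a)) ∘ T = fun a => STy.tensor A ((S ∘ T) a)) ∧
    (∀ (A : STy) (S T : STy → STy),
      (fun a => STy.lolli A (S a)) ∘ T = fun a => STy.lolli A ((S ∘ T) a)) ∧
    -- monoid laws for sequential composition
    (∀ S T U : STy → STy, (S ∘ T) ∘ U = S ∘ (T ∘ U)) ∧
    (∀ S : STy → STy, (fun a => a) ∘ S = S) ∧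
    (∀ S : STy → STy, S ∘ (fun a => a) = S) := by
  exact ⟨.id, fun _ _ hS hT => hS.comp hT, fun _ _ _ => rfl, fun _ _ _ => rfl, fun _ _ _ => rfl,
    fun _ _ _ => rfl, fun _ _ _ => rfl, fun _ _ _ => rfl, fun _ => rfl, fun _ => rfl⟩
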